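/- Let K₁ > 0, K₂ ≠ 0 with 2K₂ + K₁ ≠ 0, and T > 0. For any t ∈ ℝ, the derivative of s ↦ Λ(s,T) vanishes at s = t if and only if exp(−K₂T/2)·(2 + K₁/K₂)·exp(K₂t) = 2 + 2K₁/K₂ − (K₁/K₂)·exp(−K₂T/2). Consequently, there exists at most one t ∈ ℝ at which the derivative of s ↦ Λ(s,T) vanishes. -/

import Mathlib

open Real

/-- The function Λ(t,T) from Theorem 3.1 of the paper. -/
noncomputable def Lam (K₁ K₂ T t : ℝ) : ℝ :=
  1 + (K₁ / K₂) * (1 - Real.exp (-(K₂ * (T - t)) / 2))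
    + (K₁ / K₂) * (1 - Real.exp (-(K₂ * t) / 2))
    + (K₁ / K₂) ^ 2 * ((1 - Real.exp (-(K₂ * t) / 2))
        + (1 / 2) * (Real.exp (-(K₂ * (T + t)) / 2) - Real.exp (-(K₂ * (T - t)) / 2)))

theorem hasDerivAt_Lam (K₁ T t : ℝ) {K₂ : ℝ} (hK₂ : K₂ ≠ 0) :
    HasDerivAt (fun s => Lam K₁ K₂ T s)
      (K₁ / 4 * Real.exp (-(K₂ * t) / 2) *
        ((2 + 2 * K₁ / K₂ - (K₁ / K₂) * Real.exp (-(K₂ * T) / 2))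
          - Real.exp (-(K₂ * T) / 2) * (2 + K₁ / K₂) * Real.exp (K₂ * t))) t := by
  have hsub : HasDerivAt (fun s => Real.exp (-(K₂ * (T - s)) / 2))
      (Real.exp (-(K₂ * (T - t)) / 2) * (-(K₂ * (-1)) / 2)) t :=
    (((((hasDerivAt_id t).const_sub T).const_mul K₂).neg).div_const 2).exp
  have hneg : HasDerivAt (fun s => Real.exp (-(K₂ * s) / 2))
      (Real.exp (-(K₂ * t) / 2) * (-(K₂ * 1) / 2)) t :=
    ((((hasDerivAt_id t).const_mul K₂).neg).div_const 2).exp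
  have hadd : HasDerivAt (fun s => Real.exp (-(K₂ * (T + s)) / 2))
      (Real.exp (-(K₂ * (T + t)) / 2) * (-(K₂ * 1) / 2)) t :=
    (((((hasDerivAt_id t).const_add T).const_mul K₂).neg).div_const 2).exp
  have hLam := ((((hsub.const_sub 1).const_mul (K₁ / K₂)).const_add 1).add
    ((hneg.const_sub 1).const_mul (K₁ / K₂))).add
    (((hneg.const_sub 1).add ((hadd.sub hsub).const_mul (1 / 2))).const_mul ((K₁ / K₂) ^ 2))
  refine HasDerivAt.congr_deriv (f := fun s => Lam K₁ K₂ T s) hLam ?_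
  have exp_sub_eq : Real.exp (-(K₂ * (T - t)) / 2) =
      Real.exp (-(K₂ * T) / 2) * Real.exp (-(K₂ * t) / 2) * Real.exp (K₂ * t) := by
    rw [← Real.exp_add, ← Real.exp_add]
    ring_nf
  have exp_add_eq : Real.exp (-(K₂ * (T + t)) / 2) =
      Real.exp (-(K₂ * T) / 2) * Real.exp (-(K₂ * t) / 2) := by
    rw [← Real.exp_add]
    ring_nf
  rw [exp_sub_eq, exp_add_eq]
  generalize Real.exp (-(K₂ * T) / 2) = E
  generalize Real.exp (-(K₂ * t) / 2) = y
  generalize Real.exp (K₂ * t) = z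
  field_simp
  ring

theorem Lam_critical_point_characterization (K₁ K₂ T : ℝ)
    (hK₁ : 0 < K₁) (hK₂ : K₂ ≠ 0) (h2K : 2 * K₂ + K₁ ≠ 0) (hT : 0 < T) :
    (∀ t : ℝ, deriv (fun s => Lam K₁ K₂ T s) t = 0 ↔
      Real.exp (-(K₂ * T) / 2) * (2 + K₁ / K₂) * Real.exp (K₂ * t)
        = 2 + 2 * K₁ / K₂ - (K₁ / K₂) * Real.exp (-(K₂ * T) / 2)) ∧
    (∀ t₁ t₂ : ℝ, deriv (fun s => Lam K₁ K₂ T s) t₁ = 0 →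
      deriv (fun s => Lam K₁ K₂ T s) t₂ = 0 → t₁ = t₂) := by
  have critical_iff : ∀ t : ℝ, deriv (fun s => Lam K₁ K₂ T s) t = 0 ↔
      Real.exp (-(K₂ * T) / 2) * (2 + K₁ / K₂) * Real.exp (K₂ * t)
        = 2 + 2 * K₁ / K₂ - (K₁ / K₂) * Real.exp (-(K₂ * T) / 2) := by
    intro t
    have hfactor : K₁ / 4 * Real.exp (-(K₂ * t) / 2) ≠ 0 := by positivity
    rw [(hasDerivAt_Lam K₁ T t hK₂).deriv, mul_eq_zero_iff_left hfactor, sub_eq_zero, eq_comm]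
  refine ⟨critical_iff, fun t₁ t₂ h₁ h₂ => ?_⟩
  have hcoeff : Real.exp (-(K₂ * T) / 2) * (2 + K₁ / K₂) ≠ 0 := by
    refine mul_ne_zero (Real.exp_ne_zero _) fun h => h2K ?_
    field_simp at h
    linarith
  have hexp := ((critical_iff t₁).1 h₁).trans ((critical_iff t₂).1 h₂).symm
  exact mul_left_cancel₀ hK₂ (Real.exp_injective (mul_left_cancel₀ hcoeff hexp))
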